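/- arXiv:math/0208002 — 2 statements merged into one kernel-verified Lean document; each statement's English description precedes it below -/
import Mathlib

section
/- Let i ≥ 2 and suppose there exist 2^{i−1} + 1 totally singular i-dimensional subspaces of 𝔽₂^i × 𝔽₂^i (with respect to the quadratic form Q(a,b) = a·b) that pairwise intersect only in the zero subspace (an orthogonal spread). Then there exist 2^i (2^{i−1} + 1) pairwise distinct one-dimensional subspaces (lines) of ℝ^{2^i} such that any two distinct lines P, Q satisfy ½‖Π_P − Π_Q‖² ≥ 1 − 2^{−i}; equivalently, unit vectors u ∈ P, v ∈ Q spanning distinct lines satisfy |⟨u, v⟩| ≤ 2^{−i/2}. -/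
open Matrix BigOperators

/-- The squared Frobenius norm of a real matrix. -/
def frobSq {n : Type*} [Fintype n] (A : Matrix n n ℝ) : ℝ :=
  ∑ u, ∑ v, (A u v) ^ 2

/-- `M` is the matrix of the orthogonal projection of `ℝ^n` onto the subspace `P`:
    a symmetric idempotent matrix whose range is `P`. -/
def IsProjOnto {n : Type*} [Fintype n] [DecidableEq n]
    (M : Matrix n n ℝ) (P : Submodule ℝ (n → ℝ)) : Prop :=
  Mᵀ = M ∧ M * M = M ∧ LinearMap.range (Matrix.toLin' M) = P

/-- `U i = 𝔽₂^i`. -/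
abbrev U (i : ℕ) := Fin i → ZMod 2

/-- Standard inner product on `𝔽₂^i`. -/
def dotp {i : ℕ} (a b : U i) : ZMod 2 := ∑ j, a j * b j

/-- A subspace of `𝔽₂^i × 𝔽₂^i` is totally singular for `Q(a,b) = a·b` if
    `a·b = 0` for all its elements. -/
def TotSing {i : ℕ} (S : Submodule (ZMod 2) (U i × U i)) : Prop :=
  ∀ p ∈ S, dotp p.1 p.2 = 0

section Geometry

variable {n : Type*} [Fintype n]

theorem frobSq_eq_trace (A : Matrix n n ℝ) : frobSq A = (A * Aᵀ).trace := by
  simp [frobSq, Matrix.trace, Matrix.mul_apply, pow_two]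

variable [DecidableEq n]

theorem IsProjOnto.mul_eq_right {M N : Matrix n n ℝ} {P : Submodule ℝ (n → ℝ)}
    (hM : IsProjOnto M P) (hN : IsProjOnto N P) : M * N = N := by
  refine Matrix.toLin'.injective (LinearMap.ext fun x => ?_)
  obtain ⟨y, hy⟩ : Matrix.toLin' N x ∈ LinearMap.range (Matrix.toLin' M) := by
    rw [hM.2.2, ← hN.2.2]; exact LinearMap.mem_range_self _ x
  rw [Matrix.toLin'_mul, LinearMap.comp_apply, ← hy, ← LinearMap.comp_apply, ← Matrix.toLin'_mul,
    hM.2.1]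

theorem IsProjOnto.unique {M N : Matrix n n ℝ} {P : Submodule ℝ (n → ℝ)}
    (hM : IsProjOnto M P) (hN : IsProjOnto N P) : M = N := by
  have h := congrArg Matrix.transpose (hM.mul_eq_right hN)
  rw [Matrix.transpose_mul, hM.1, hN.1] at h
  exact (hN.mul_eq_right hM).symm.trans h

theorem IsProjOnto.trace_eq_finrank {M : Matrix n n ℝ} {P : Submodule ℝ (n → ℝ)}
    (hM : IsProjOnto M P) : M.trace = Module.finrank ℝ P := by
  have h : IsIdempotentElem (Matrix.toLin' M) := by
    rw [IsIdempotentElem, Module.End.mul_eq_comp, ← Matrix.toLin'_mul, hM.2.1]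
  have := (LinearMap.IsIdempotentElem.isProj_range _ h).trace
  rwa [Matrix.trace_toLin'_eq, hM.2.2] at this

theorem IsProjOnto.frobSq_sub {M N : Matrix n n ℝ} {P Q : Submodule ℝ (n → ℝ)}
    (hM : IsProjOnto M P) (hN : IsProjOnto N Q) :
    frobSq (M - N) = M.trace + N.trace - 2 * (M * N).trace := by
  rw [frobSq_eq_trace, Matrix.transpose_sub, hM.1, hN.1, sub_mul, mul_sub, mul_sub, hM.2.1, hN.2.1,
    Matrix.trace_sub, Matrix.trace_sub, Matrix.trace_sub, Matrix.trace_mul_comm N M]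
  ring

theorem isProjOnto_vecMulVec {P : Submodule ℝ (n → ℝ)} (hP : Module.finrank ℝ P = 1)
    {u : n → ℝ} (hu : u ∈ P) (h1 : u ⬝ᵥ u = 1) : IsProjOnto (vecMulVec u u) P := by
  refine ⟨by rw [transpose_vecMulVec], by rw [vecMulVec_mul_vecMulVec, h1, one_smul], ?_⟩
  have hu0 : u ≠ 0 := by rintro rfl; simp at h1
  ext x
  constructor
  · rintro ⟨y, rfl⟩
    rw [toLin'_apply, vecMulVec_mulVec, op_smul_eq_smul]
    exact P.smul_mem _ hu
  · intro hx
    obtain ⟨c, hc⟩ := exists_smul_eq_of_finrank_eq_one hP (x := ⟨u, hu⟩) (by simpa using hu0) ⟨x, hx⟩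
    have hc' : c • u = x := congrArg Subtype.val hc
    refine ⟨x, ?_⟩
    rw [toLin'_apply, vecMulVec_mulVec, ← hc']
    simp [h1]

theorem IsProjOnto.trace_mul_eq {M N : Matrix n n ℝ} {P Q : Submodule ℝ (n → ℝ)}
    (hM : IsProjOnto M P) (hN : IsProjOnto N Q)
    (hP : Module.finrank ℝ P = 1) (hQ : Module.finrank ℝ Q = 1)
    {u v : n → ℝ} (hu : u ∈ P) (hv : v ∈ Q) (hu1 : u ⬝ᵥ u = 1) (hv1 : v ⬝ᵥ v = 1) :
    (M * N).trace = (u ⬝ᵥ v) ^ 2 := by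
  rw [hM.unique (isProjOnto_vecMulVec hP hu hu1), hN.unique (isProjOnto_vecMulVec hQ hv hv1),
    vecMulVec_mul_vecMulVec, trace_vecMulVec, dotProduct_smul, smul_eq_mul, pow_two]

/-- Trace-one orthogonal projections with pairwise small trace products give a line packing. -/
theorem exists_lines_of_projections {K : Type*} [Fintype K] (M : K → Matrix n n ℝ)
    (hsymm : ∀ k, (M k)ᵀ = M k) (hidem : ∀ k, M k * M k = M k) (htr : ∀ k, (M k).trace = 1)
    {c : ℝ} (hc : c < 1) (hM : ∀ k l, k ≠ l → (M k * M l).trace ≤ c) :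
    ∃ Pk : Finset (Submodule ℝ (n → ℝ)),
      Pk.card = Fintype.card K ∧
      (∀ P ∈ Pk, Module.finrank ℝ P = 1) ∧
      (∀ P ∈ Pk, ∀ Q ∈ Pk, P ≠ Q →
        (∀ MP MQ : Matrix n n ℝ, IsProjOnto MP P → IsProjOnto MQ Q →
          (1 / 2 : ℝ) * frobSq (MP - MQ) ≥ 1 - c) ∧
        (∀ u ∈ P, ∀ v ∈ Q, u ⬝ᵥ u = 1 → v ⬝ᵥ v = 1 → (u ⬝ᵥ v) ^ 2 ≤ c)) := by
  classical
  set R : K → Submodule ℝ (n → ℝ) := fun k => LinearMap.range (Matrix.toLin' (M k)) with hR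
  have hproj : ∀ k, IsProjOnto (M k) (R k) := fun k => ⟨hsymm k, hidem k, rfl⟩
  have hrank : ∀ k, Module.finrank ℝ (R k) = 1 := fun k => by
    have := (hproj k).trace_eq_finrank
    rw [htr k] at this
    exact_mod_cast this.symm
  have hinj : Function.Injective R := fun k l hkl => by
    by_contra hne
    have h := hM k l hne
    rw [(hkl ▸ hproj k : IsProjOnto (M k) (R l)).mul_eq_right (hproj l), htr] at h
    exact absurd h hc.not_ge
  refine ⟨Finset.univ.image R, ?_, ?_, ?_⟩
  · rw [Finset.card_image_of_injective _ hinj, Finset.card_univ]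
  · simpa using hrank
  · simp only [Finset.mem_image, Finset.mem_univ, true_and]
    rintro _ ⟨k, rfl⟩ _ ⟨l, rfl⟩ hne
    have hkl := hM k l fun h => hne (h ▸ rfl)
    refine ⟨fun MP MQ hP hQ => ?_, fun u hu v hv hu1 hv1 => ?_⟩
    · rw [hP.unique (hproj k), hQ.unique (hproj l), (hproj k).frobSq_sub (hproj l), htr, htr]
      linarith
    · rwa [← (hproj k).trace_mul_eq (hproj l) (hrank k) (hrank l) hu hv hu1 hv1]

end Geometry

section Heisenberg

/-- The character `z ↦ (-1)^z` of `𝔽₂`. -/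
def signChar (z : ZMod 2) : ℝ := if z = 0 then 1 else -1

theorem signChar_zero : signChar 0 = 1 := if_pos rfl

theorem signChar_add (y z : ZMod 2) : signChar (y + z) = signChar y * signChar z := by
  have h : ∀ z : ZMod 2, z = 0 ∨ z = 1 := by decide
  rcases h y with rfl | rfl <;> rcases h z with rfl | rfl <;>
    simp [signChar, CharTwo.add_self_eq_zero]

theorem signChar_mul_self (z : ZMod 2) : signChar z * signChar z = 1 := by
  rw [← signChar_add, CharTwo.add_self_eq_zero, signChar_zero]

theorem sum_signChar_dotProduct {i : ℕ} (b : U i) :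
    ∑ y : U i, signChar (b ⬝ᵥ y) = if b = 0 then (2 : ℝ) ^ i else 0 := by
  split_ifs with hb
  · simp [hb, signChar_zero]
  · obtain ⟨j, hj⟩ := Function.ne_iff.mp hb
    have hbj : b j = 1 := (by decide : ∀ z : ZMod 2, z ≠ 0 → z = 1) _ hj
    have h := Equiv.sum_comp (Equiv.addRight (Pi.single j 1 : U i)) fun y => signChar (b ⬝ᵥ y)
    simp only [Equiv.coe_addRight, dotProduct_add, signChar_add, dotProduct_single, hbj, mul_one,
      ← Finset.sum_mul] at h
    have h1 : signChar 1 = -1 := by simp [signChar]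
    rw [h1] at h
    linarith

/-- The operator `X(a) Z(b)`, translation by `a` after multiplication by `(-1)^(b·y)`. -/
def heisenberg {i : ℕ} (p : U i × U i) : Matrix (U i) (U i) ℝ :=
  fun x y => if x = y + p.1 then signChar (p.2 ⬝ᵥ y) else 0

theorem heisenberg_mul {i : ℕ} (p q : U i × U i) :
    heisenberg p * heisenberg q = signChar (p.2 ⬝ᵥ q.1) • heisenberg (p + q) := by
  ext x z
  simp only [heisenberg, mul_apply, mul_ite, ite_mul, mul_zero, zero_mul, Matrix.smul_apply, smul_eq_mul,
    Finset.sum_ite_eq', Finset.mem_univ, if_true, Prod.fst_add, Prod.snd_add]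
  rw [show z + (p.1 + q.1) = z + q.1 + p.1 by abel]
  split_ifs
  · simp only [dotProduct_add, add_dotProduct, signChar_add]; ring
  · rfl

theorem heisenberg_transpose {i : ℕ} {p : U i × U i} (hp : p.1 ⬝ᵥ p.2 = 0) :
    (heisenberg p)ᵀ = heisenberg p := by
  ext x y
  have h : y = x + p.1 ↔ x = y + p.1 := by
    constructor <;> rintro rfl <;> rw [add_assoc, ZModModule.add_self, add_zero]
  simp only [heisenberg, transpose_apply, h]
  split_ifs with hxy
  · rw [hxy, dotProduct_add, dotProduct_comm p.2 p.1, hp, add_zero]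
  · rfl

theorem heisenberg_trace {i : ℕ} (p : U i × U i) :
    (heisenberg p).trace = if p = 0 then (2 : ℝ) ^ i else 0 := by
  by_cases h : p.1 = 0 <;>
    simp [trace, heisenberg, h, sum_signChar_dotProduct, Prod.ext_iff]

theorem heisenberg_trace_mul {i : ℕ} {p : U i × U i} (hp : p.1 ⬝ᵥ p.2 = 0) (q : U i × U i) :
    (heisenberg p * heisenberg q).trace = if p = q then (2 : ℝ) ^ i else 0 := by
  rw [heisenberg_mul, trace_smul, heisenberg_trace, smul_eq_mul]
  simp only [← ZModModule.sub_eq_add p q, sub_eq_zero]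
  split_ifs with h
  · rw [← h, dotProduct_comm, hp, signChar_zero, one_mul]
  · rw [mul_zero]

/-- In characteristic two, an alternating form is the polarization of a quadratic form. -/
theorem exists_quadratic_of_alt {i : ℕ} (B : U i →ₗ[ZMod 2] U i →ₗ[ZMod 2] ZMod 2)
    (hB : B.IsAlt) : ∃ q : U i → ZMod 2, ∀ x y, q (x + y) = q x + q y + B x y := by
  set β : Fin i → Fin i → ZMod 2 := fun j k => B (Pi.single j 1) (Pi.single k 1) with hβ
  have hexp : ∀ x y, B x y = ∑ j, ∑ k, x j * y k * β j k := fun x y => by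
    conv_lhs => rw [pi_eq_sum_univ' x, pi_eq_sum_univ' y]
    simp only [map_sum, map_smul, LinearMap.sum_apply, LinearMap.smul_apply, smul_eq_mul,
      Finset.mul_sum, hβ]
    rw [Finset.sum_comm]
    refine Finset.sum_congr rfl fun j _ => Finset.sum_congr rfl fun k _ => ?_
    ring
  have hdiag : ∀ j, β j j = 0 := fun j => hB _
  have hsymm : ∀ j k, β k j = β j k := fun j k => by
    simp only [hβ]
    rw [← hB.neg, ZModModule.neg_eq_self]
  refine ⟨fun x => ∑ j, ∑ k, if j < k then x j * x k * β j k else 0, fun x y => ?_⟩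
  have hswap : ∑ j, ∑ k, (if j < k then y j * x k * β j k else 0) =
      ∑ j, ∑ k, if k < j then x j * y k * β j k else 0 := by
    rw [Finset.sum_comm]
    refine Finset.sum_congr rfl fun j _ => Finset.sum_congr rfl fun k _ => ?_
    rw [hsymm, mul_comm (y k)]
  have hB' : B x y = ∑ j, ∑ k, (if j < k then x j * y k * β j k else 0) +
      ∑ j, ∑ k, if j < k then y j * x k * β j k else 0 := by
    rw [hswap, hexp]
    simp only [← Finset.sum_add_distrib]
    refine Finset.sum_congr rfl fun j _ => Finset.sum_congr rfl fun k _ => ?_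
    rcases lt_trichotomy j k with h | rfl | h
    · simp [h, h.not_gt]
    · simp [hdiag]
    · simp [h, h.not_gt]
  rw [hB']
  simp only [← Finset.sum_add_distrib]
  refine Finset.sum_congr rfl fun j _ => Finset.sum_congr rfl fun k _ => ?_
  split_ifs
  · simp only [Pi.add_apply]; ring
  · simp

/-- The projection onto the joint eigenspace, with eigenvalues `(-1)^(l·w + q w)`, of the operators
`heisenberg (φ w)`. -/
noncomputable def eigenProj {i : ℕ} (φ : U i → U i × U i) (q : U i → ZMod 2) (l : U i) :
    Matrix (U i) (U i) ℝ :=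
  ((2 : ℝ) ^ i)⁻¹ • ∑ w, signChar (l ⬝ᵥ w + q w) • heisenberg (φ w)

variable {i : ℕ} {φ ψ : U i →ₗ[ZMod 2] U i × U i} {q q' : U i → ZMod 2}

theorem eigenProj_transpose (hφ : ∀ w, (φ w).1 ⬝ᵥ (φ w).2 = 0) (l : U i) :
    (eigenProj φ q l)ᵀ = eigenProj φ q l := by
  simp only [eigenProj, transpose_smul, transpose_sum, heisenberg_transpose (hφ _)]

theorem eigenProj_mul_self (hq : ∀ x y, q (x + y) = q x + q y + (φ x).2 ⬝ᵥ (φ y).1) (l : U i) :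
    eigenProj φ q l * eigenProj φ q l = eigenProj φ q l := by
  have key : ∀ x y, signChar (l ⬝ᵥ x + q x) • heisenberg (φ x) *
      signChar (l ⬝ᵥ y + q y) • heisenberg (φ y) =
      signChar (l ⬝ᵥ (y + x) + q (y + x)) • heisenberg (φ (y + x)) := fun x y => by
    rw [smul_mul_smul_comm, heisenberg_mul, smul_smul, add_comm y x, hq, map_add]
    simp only [dotProduct_add, signChar_add]
    congr 1
    ring
  have hsum : ∀ x, ∑ y, signChar (l ⬝ᵥ (y + x) + q (y + x)) • heisenberg (φ (y + x)) =
      ∑ y, signChar (l ⬝ᵥ y + q y) • heisenberg (φ y) := fun x =>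
    Equiv.sum_comp (Equiv.addRight x) fun y => signChar (l ⬝ᵥ y + q y) • heisenberg (φ y)
  rw [eigenProj, smul_mul_smul_comm, Finset.sum_mul_sum]
  simp only [key, hsum, Finset.sum_const, Finset.card_univ, ← Nat.cast_smul_eq_nsmul ℝ, smul_smul]
  congr 1
  simp [ZMod.card]

theorem eigenProj_trace_mul (hφ : ∀ w, (φ w).1 ⬝ᵥ (φ w).2 = 0) (l m : U i) :
    (eigenProj φ q l * eigenProj ψ q' m).trace = ((2 : ℝ) ^ i)⁻¹ *
      ∑ x, ∑ y, if φ x = ψ y then signChar (l ⬝ᵥ x + q x) * signChar (m ⬝ᵥ y + q' y) else 0 := by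
  rw [eigenProj, eigenProj, smul_mul_smul_comm, Finset.sum_mul_sum]
  simp only [smul_mul_smul_comm, Finset.mul_sum, trace_smul, trace_sum, smul_eq_mul,
    heisenberg_trace_mul (hφ _)]
  refine Finset.sum_congr rfl fun x _ => Finset.sum_congr rfl fun y _ => ?_
  split_ifs
  · field_simp
  · simp

theorem eigenProj_trace (hφ : Function.Injective φ) (hq : q 0 = 0) (l : U i) :
    (eigenProj φ q l).trace = 1 := by
  have h : ∀ x, φ x = 0 ↔ x = 0 := fun x => map_eq_zero_iff φ hφ
  simp [eigenProj, trace_sum, heisenberg_trace, h, hq, signChar_zero]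

theorem eigenProj_trace_mul_of_ne (hφ : Function.Injective φ)
    (hs : ∀ w, (φ w).1 ⬝ᵥ (φ w).2 = 0) {l m : U i} (hlm : l ≠ m) :
    (eigenProj φ q l * eigenProj φ q m).trace = 0 := by
  have h : ∀ x, signChar (l ⬝ᵥ x + q x) * signChar (m ⬝ᵥ x + q x) = signChar ((l - m) ⬝ᵥ x) :=
    fun x => by
      rw [ZModModule.sub_eq_add, add_dotProduct, signChar_add, signChar_add, signChar_add,
        mul_mul_mul_comm, signChar_mul_self, mul_one]
  simp [eigenProj_trace_mul hs, hφ.eq_iff, h, -sub_dotProduct, sum_signChar_dotProduct, sub_eq_zero,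
    hlm]

theorem eigenProj_trace_mul_of_disjoint (hφ : Function.Injective φ) (hψ : Function.Injective ψ)
    (hs : ∀ w, (φ w).1 ⬝ᵥ (φ w).2 = 0) (hdisj : ∀ x y, φ x = ψ y → φ x = 0)
    (hq : q 0 = 0) (hq' : q' 0 = 0) (l m : U i) :
    (eigenProj φ q l * eigenProj ψ q' m).trace = ((2 : ℝ) ^ i)⁻¹ := by
  have h : ∀ x y, φ x = ψ y ↔ x = 0 ∧ y = 0 := fun x y => by
    refine ⟨fun hxy => ?_, fun ⟨hx, hy⟩ => by rw [hx, hy, map_zero, map_zero]⟩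
    have h0 := hdisj x y hxy
    exact ⟨(map_eq_zero_iff φ hφ).mp h0, (map_eq_zero_iff ψ hψ).mp (hxy ▸ h0)⟩
  simp [eigenProj_trace_mul hs, h, ite_and, hq, hq', signChar_zero]

/-- Coordinates on a totally singular subspace, with a quadratic form polarizing to the commutation
cocycle of the Heisenberg operators. -/
theorem exists_param_of_totSing {i : ℕ} (S : Submodule (ZMod 2) (U i × U i)) (hts : TotSing S)
    (hdim : Module.finrank (ZMod 2) S = i) :
    ∃ (φ : U i →ₗ[ZMod 2] U i × U i) (q : U i → ZMod 2), Function.Injective φ ∧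
      (∀ w, φ w ∈ S) ∧ ∀ x y, q (x + y) = q x + q y + (φ x).2 ⬝ᵥ (φ y).1 := by
  let e : U i ≃ₗ[ZMod 2] S := LinearEquiv.ofFinrankEq _ _ (by simp [hdim])
  let φ : U i →ₗ[ZMod 2] U i × U i := S.subtype ∘ₗ e.toLinearMap
  let B : U i →ₗ[ZMod 2] U i →ₗ[ZMod 2] ZMod 2 :=
    (dotProductBilin (ZMod 2) (ZMod 2)).compl₁₂ (LinearMap.snd _ _ _ ∘ₗ φ) (LinearMap.fst _ _ _ ∘ₗ φ)
  obtain ⟨q, hq⟩ := exists_quadratic_of_alt B fun w =>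
    (dotProduct_comm _ _).trans (hts (φ w) (e w).2)
  exact ⟨φ, q, Subtype.val_injective.comp e.injective, fun w => (e w).2, hq⟩

end Heisenberg

/-- from an orthogonal spread (`2^{i−1} + 1` totally singular
    `i`-dimensional subspaces of `𝔽₂^i × 𝔽₂^i` pairwise meeting in `0`) one obtains
    `2^i(2^{i−1} + 1)` distinct lines in `ℝ^{2^i}` with pairwise squared chordal
    distance at least `1 − 2^{−i}`, i.e. pairwise angle at least `arccos 2^{−i/2}`. -/
theorem stmt17 (i : ℕ) (hi : 2 ≤ i)
    (S : Fin (2 ^ (i - 1) + 1) → Submodule (ZMod 2) (U i × U i))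
    (hts : ∀ r, TotSing (S r))
    (hdim : ∀ r, Module.finrank (ZMod 2) (S r) = i)
    (hint : ∀ r t, r ≠ t → S r ⊓ S t = ⊥) :
    ∃ Pk : Finset (Submodule ℝ (Fin (2 ^ i) → ℝ)),
      Pk.card = 2 ^ i * (2 ^ (i - 1) + 1) ∧
      (∀ P ∈ Pk, Module.finrank ℝ P = 1) ∧
      (∀ P ∈ Pk, ∀ Q ∈ Pk, P ≠ Q →
        (∀ MP MQ : Matrix (Fin (2 ^ i)) (Fin (2 ^ i)) ℝ,
          IsProjOnto MP P → IsProjOnto MQ Q →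
          (1 / 2 : ℝ) * frobSq (MP - MQ) ≥ 1 - ((2 : ℝ) ^ i)⁻¹) ∧
        (∀ u ∈ P, ∀ v ∈ Q, (∑ j, u j ^ 2) = 1 → (∑ j, v j ^ 2) = 1 →
          |∑ j, u j * v j| ≤ (Real.sqrt (2 ^ i))⁻¹)) := by
  choose φ q hinj hmem hq using fun r => exists_param_of_totSing (S r) (hts r) (hdim r)
  have hq0 : ∀ r, q r 0 = 0 := fun r => by simpa using hq r 0 0
  have hs : ∀ r w, (φ r w).1 ⬝ᵥ (φ r w).2 = 0 := fun r w => hts r _ (hmem r w)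
  let e : Fin (2 ^ i) ≃ U i := Fintype.equivOfCardEq (by simp [ZMod.card])
  have htrace : ∀ A : Matrix (U i) (U i) ℝ, (A.submatrix e e).trace = A.trace := fun A =>
    Equiv.sum_comp e fun x => A x x
  have hc : ((2 : ℝ) ^ i)⁻¹ < 1 := inv_lt_one_of_one_lt₀ (one_lt_pow₀ one_lt_two (by omega))
  obtain ⟨Pk, hcard, hrank, hPk⟩ := exists_lines_of_projections
    (K := Fin (2 ^ (i - 1) + 1) × U i)
    (fun k => (eigenProj (φ k.1) (q k.1) k.2).submatrix e e)
    (fun k => by rw [transpose_submatrix, eigenProj_transpose (hs k.1)])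
    (fun k => by rw [submatrix_mul_equiv, eigenProj_mul_self (hq k.1)])
    (fun k => by rw [htrace, eigenProj_trace (hinj k.1) (hq0 k.1)]) hc (by
      rintro ⟨r, l⟩ ⟨t, m⟩ hne
      rw [submatrix_mul_equiv, htrace]
      by_cases hrt : r = t
      · subst hrt
        rw [eigenProj_trace_mul_of_ne (hinj r) (hs r) fun h => hne (congrArg _ h)]
        positivity
      · refine (eigenProj_trace_mul_of_disjoint (hinj r) (hinj t) (hs r) (fun x y hxy => ?_)
          (hq0 r) (hq0 t) l m).le
        exact (Submodule.disjoint_def.mp (disjoint_iff.mpr (hint r t hrt))) _ (hmem r x)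
          (hxy ▸ hmem t y))
  refine ⟨Pk, ?_, hrank, fun P hP Q hQ hPQ =>
    ⟨(hPk P hP Q hQ hPQ).1, fun u hu v hv hu1 hv1 => ?_⟩⟩
  · rw [hcard]
    simp [ZMod.card, mul_comm]
  · rw [← Real.sqrt_inv]
    exact Real.abs_le_sqrt ((hPk P hP Q hQ hPQ).2 u hu v hv (by simpa [dotProduct, pow_two] using hu1)
      (by simpa [dotProduct, pow_two] using hv1))
end

section
/- Let p be a prime with p = 3 or p ≡ 7 (mod 8), and let H be a ((p+1)/2) × ((p+1)/2) real matrix with all entries ±1 satisfying H Hᵗ = ((p+1)/2)·I, whose rows and columns are indexed by 0, 1, …, (p−1)/2 and whose row 0 and column 0 consist entirely of +1's (a normalized Hadamard matrix). Let q₁, …, q_{(p−1)/2} be the nonzero quadratic residues modulo p, fix a quadratic nonresidue k modulo p, and set C = (1 + √(p+2))/√(p+1). For 0 ≤ t ≤ (p−1)/2 and 0 ≤ c ≤ p−1, let P_{t,c} be the subspace of ℝ^p (with coordinates e₀, …, e_{p−1} indexed by ℤ/pℤ) spanned by the (p−1)/2 vectors e_{q_s + c} + H_{s,t}·C·e_{k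 q_s + c}, for 1 ≤ s ≤ (p−1)/2. Then the P_{t,c} are p(p+1)/2 pairwise distinct subspaces of ℝ^p, each of dimension (p−1)/2, and for any two distinct planes P, Q among them, ½‖Π_P − Π_Q‖² = (p+1)²/(4(p+2)); this common squared distance equals the simplex bound n(m−n)N/(m(N−1)) with m = p, n = (p−1)/2, N = p(p+1)/2, so the packing is optimal. -/
open Matrix BigOperators

/-- A matrix of an orthogonal projection is determined by its range. -/
lemma IsProjOnto.unique_s19 {n : Type*} [Fintype n] [DecidableEq n] {M M' : Matrix n n ℝ}
    {P : Submodule ℝ (n → ℝ)} (h : IsProjOnto M P) (h' : IsProjOnto M' P) : M = M' := by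
  have mul_eq {A B : Matrix n n ℝ} (hA : IsProjOnto A P) (hB : IsProjOnto B P) :
      A * B = B := by
    apply Matrix.toLin'.injective
    ext1 i
    ext1
    simp only [LinearMap.comp_apply]
    obtain ⟨y, hy⟩ : toLin' B (LinearMap.single ℝ (fun _ => ℝ) i 1) ∈
        LinearMap.range (toLin' A) := by
      rw [hA.2.2, ← hB.2.2]
      exact LinearMap.mem_range_self _ _
    rw [Matrix.toLin'_mul, LinearMap.comp_apply, ← hy, ← LinearMap.comp_apply,
      ← Matrix.toLin'_mul, hA.2.1]
  calc M = Mᵀ := h.1.symm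
    _ = (M' * M)ᵀ := by rw [mul_eq h' h]
    _ = M * M' := by rw [Matrix.transpose_mul, h.1, h'.1]
    _ = M' := mul_eq h h'

/-- The projection matrix built from an orthogonal family of vectors of squared norm `a`. -/
noncomputable def orthoProj {ι n : Type*} [Fintype ι] (a : ℝ) (w : ι → n → ℝ) : Matrix n n ℝ :=
  a⁻¹ • ∑ s, vecMulVec (w s) (w s)

lemma orthoProj_transpose {ι n : Type*} [Fintype ι] (a : ℝ) (w : ι → n → ℝ) :
    (orthoProj a w)ᵀ = orthoProj a w := by
  simp [orthoProj, Matrix.transpose_sum, Matrix.transpose_vecMulVec]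

lemma orthoProj_mulVec {ι n : Type*} [Fintype ι] [Fintype n] (a : ℝ) (w : ι → n → ℝ)
    (x : n → ℝ) : orthoProj a w *ᵥ x = ∑ s, (a⁻¹ * (w s ⬝ᵥ x)) • w s := by
  simp [orthoProj, Matrix.smul_mulVec, Matrix.sum_mulVec, Matrix.vecMulVec_mulVec,
    Finset.smul_sum, smul_smul]

lemma trace_orthoProj_mul {ι n : Type*} [Fintype ι] [Fintype n] (a : ℝ) (w w' : ι → n → ℝ) :
    (orthoProj a w * orthoProj a w').trace = a⁻¹ ^ 2 * ∑ s, ∑ s', (w s ⬝ᵥ w' s') ^ 2 := by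
  simp only [orthoProj, Matrix.smul_mul, Matrix.mul_smul, Matrix.trace_smul, smul_eq_mul]
  rw [Finset.sum_mul_sum]
  simp only [Matrix.trace_sum, Matrix.vecMulVec_mul_vecMulVec, Matrix.trace_vecMulVec,
    dotProduct_smul, smul_eq_mul, ← pow_two]
  ring

lemma orthoProj_isProjOnto {ι n : Type*} [Fintype ι] [DecidableEq ι] [Fintype n]
    [DecidableEq n] {a : ℝ} (ha : a ≠ 0) {w : ι → n → ℝ}
    (hw : ∀ s s', w s ⬝ᵥ w s' = if s = s' then a else 0) :
    IsProjOnto (orthoProj a w) (Submodule.span ℝ (Set.range w)) := by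
  have fix (s : ι) : orthoProj a w *ᵥ w s = w s := by
    simp [orthoProj_mulVec, hw, ha]
  refine ⟨orthoProj_transpose a w, ?_, le_antisymm ?_ ?_⟩
  · apply Matrix.toLin'.injective
    refine LinearMap.ext fun x => ?_
    rw [Matrix.toLin'_apply, Matrix.toLin'_apply, ← Matrix.mulVec_mulVec]
    conv_rhs => rw [orthoProj_mulVec]
    rw [orthoProj_mulVec a w x, Matrix.mulVec_sum]
    simp [Matrix.mulVec_smul, fix]
  · rintro _ ⟨x, rfl⟩
    rw [Matrix.toLin'_apply, orthoProj_mulVec]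
    exact Submodule.sum_mem _ fun s _ =>
      Submodule.smul_mem _ _ (Submodule.subset_span (Set.mem_range_self s))
  · rw [Submodule.span_le]
    rintro _ ⟨s, rfl⟩
    exact ⟨w s, by rw [Matrix.toLin'_apply, fix]⟩

lemma linearIndependent_of_dotProduct {ι n : Type*} [Fintype ι] [DecidableEq ι] [Fintype n]
    {a : ℝ} (ha : a ≠ 0) {w : ι → n → ℝ}
    (hw : ∀ s s', w s ⬝ᵥ w s' = if s = s' then a else 0) : LinearIndependent ℝ w := by
  rw [Fintype.linearIndependent_iff]
  intro g hg i
  have h : w i ⬝ᵥ ∑ s, g s • w s = 0 := by rw [hg, dotProduct_zero]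
  simpa [dotProduct_sum, dotProduct_smul, hw, ha] using h

lemma frobSq_sub {n : Type*} [Fintype n] {M M' : Matrix n n ℝ} (h : Mᵀ = M) (h' : M'ᵀ = M') :
    frobSq (M - M') = (M * M).trace - 2 * (M * M').trace + (M' * M').trace := by
  have key (A B : Matrix n n ℝ) (hB : Bᵀ = B) : (A * B).trace = ∑ u, ∑ v, A u v * B u v := by
    simp only [Matrix.trace, Matrix.diag, Matrix.mul_apply]
    refine Finset.sum_congr rfl fun u _ => Finset.sum_congr rfl fun v _ => ?_
    rw [← Matrix.transpose_apply B, hB]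
  rw [key M M h, key M M' h', key M' M' h', frobSq]
  simp only [Finset.mul_sum, ← Finset.sum_sub_distrib, ← Finset.sum_add_distrib]
  refine Finset.sum_congr rfl fun u _ => Finset.sum_congr rfl fun v _ => ?_
  rw [Matrix.sub_apply]
  ring

lemma dotProduct_single_add_smul_single {n : Type*} [Fintype n] [DecidableEq n]
    (a b a' b' : n) (α β : ℝ) :
    (Pi.single a 1 + α • Pi.single b 1 : n → ℝ) ⬝ᵥ (Pi.single a' 1 + β • Pi.single b' 1) =
      (if a = a' then 1 else 0) + β * (if a = b' then 1 else 0) +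
        α * (if b = a' then 1 else 0) + α * β * (if b = b' then 1 else 0) := by
  simp only [dotProduct_add, dotProduct_smul, dotProduct_single_one, Pi.add_apply, Pi.smul_apply,
    Pi.single_apply, smul_eq_mul, eq_comm (a := a'), eq_comm (a := b')]
  ring

lemma sum_mul_column_of_hadamard {n : ℕ} {a : ℝ} (ha : a ≠ 0)
    {H : Matrix (Fin (n + 1)) (Fin (n + 1)) ℝ} (hH : H * Hᵀ = a • (1 : Matrix _ _ ℝ))
    (hrow : ∀ t, H 0 t = 1) {t t' : Fin (n + 1)} (htt : t ≠ t') :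
    ∑ s : Fin n, H s.succ t * H s.succ t' = -1 := by
  have h1 : H * (a⁻¹ • Hᵀ) = 1 := by
    rw [Matrix.mul_smul, hH, smul_smul, inv_mul_cancel₀ ha, one_smul]
  have h2 : ((a⁻¹ • Hᵀ) * H) t t' = (1 : Matrix _ _ ℝ) t t' := by rw [mul_eq_one_comm.mp h1]
  rw [Matrix.one_apply_ne htt, Matrix.smul_mul, Matrix.smul_apply, smul_eq_mul,
    mul_eq_zero, or_iff_right (inv_ne_zero ha), Matrix.mul_apply, Fin.sum_univ_succ] at h2
  simp only [Matrix.transpose_apply, hrow] at h2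
  linarith

section Residues

variable {p : ℕ} [Fact p.Prime]

lemma isSquare_or_isSquare_neg (hp : p % 4 = 3) (x : ZMod p) : IsSquare x ∨ IsSquare (-x) := by
  have hp2 : p ≠ 2 := by rintro rfl; omega
  have hc : ringChar (ZMod p) ≠ 2 := by rwa [ZMod.ringChar_zmod_n]
  by_cases hx : x = 0
  · left; rw [hx]; exact IsSquare.zero
  have hm : ¬ IsSquare (-1 : ZMod p) := by
    rw [ZMod.exists_sq_eq_neg_one_iff]; omega
  by_contra! h
  have e1 := (quadraticChar_neg_one_iff_not_isSquare (a := x)).mpr h.1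
  have e2 := (quadraticChar_neg_one_iff_not_isSquare (a := -x)).mpr h.2
  have e3 := (quadraticChar_neg_one_iff_not_isSquare (a := (-1 : ZMod p))).mpr hm
  rw [← neg_one_mul, map_mul, e3, e1] at e2
  norm_num at e2

/-- The number of pairs `(s, s')` with `α * q s + β * q s' = d`, as a real number. -/
noncomputable def pairCount {n : ℕ} (q : Fin n → ZMod p) (α β d : ZMod p) : ℝ :=
  ∑ s, ∑ s', if α * q s + β * q s' = d then 1 else 0

variable {n : ℕ} {q : Fin n → ZMod p}

lemma pairCount_neg (α β d : ZMod p) : pairCount q α β (-d) = pairCount q (-β) (-α) d := by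
  rw [pairCount, Finset.sum_comm, pairCount]
  refine Finset.sum_congr rfl fun s _ => Finset.sum_congr rfl fun s' _ => ?_
  congr 1
  rw [eq_iff_iff]
  constructor <;> intro h <;> linear_combination -h

lemma sum_pairCount (α β : ZMod p) : ∑ d, pairCount q α β d = (n : ℝ) ^ 2 := by
  simp only [pairCount]
  rw [Finset.sum_comm]
  simp_rw [Finset.sum_comm (s := (Finset.univ : Finset (ZMod p)))]
  simp [pow_two]

lemma sum_comp_mul_residue (hq : Function.Injective q)
    (hqr : Set.range q = {x : ZMod p | x ≠ 0 ∧ IsSquare x}) {u : ZMod p} (hu : u ≠ 0)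
    (hsq : IsSquare u) (f : ZMod p → ℝ) : ∑ s, f (u * q s) = ∑ s, f (q s) := by
  have hex (s : Fin n) : ∃ s', q s' = u * q s := by
    have h : q s ∈ {x : ZMod p | x ≠ 0 ∧ IsSquare x} := hqr ▸ Set.mem_range_self s
    have : u * q s ∈ Set.range q := by
      rw [hqr]; exact ⟨mul_ne_zero hu h.1, hsq.mul h.2⟩
    exact this
  choose σ hσ using hex
  have hinj : Function.Injective σ := fun s s' h =>
    hq (mul_left_cancel₀ hu (by rw [← hσ, ← hσ, h]))
  have hbij : Function.Bijective σ := Finite.injective_iff_bijective.mp hinj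
  simp_rw [← hσ]
  exact hbij.sum_comp fun s => f (q s)

lemma pairCount_mul (hq : Function.Injective q)
    (hqr : Set.range q = {x : ZMod p | x ≠ 0 ∧ IsSquare x}) {u : ZMod p} (hu : u ≠ 0)
    (hsq : IsSquare u) (α β d : ZMod p) : pairCount q α β (u * d) = pairCount q α β d := by
  rw [pairCount, ← sum_comp_mul_residue hq hqr hu hsq
    (fun x => ∑ s', if α * x + β * q s' = u * d then (1 : ℝ) else 0)]
  refine Finset.sum_congr rfl fun s _ => ?_
  rw [← sum_comp_mul_residue hq hqr hu hsq
    (fun y => if α * (u * q s) + β * y = u * d then (1 : ℝ) else 0)]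
  refine Finset.sum_congr rfl fun s' _ => ?_
  congr 1
  rw [eq_iff_iff, ← mul_right_inj' hu (b := α * q s + β * q s')]
  ring_nf

/-- A function on `ZMod p` invariant under negation and under multiplication by nonzero squares
is constant away from `0`. -/
lemma sum_eq_of_invariant (hp : p % 4 = 3) {f : ZMod p → ℝ} (hneg : ∀ d, f (-d) = f d)
    (hmul : ∀ u d, u ≠ 0 → IsSquare u → f (u * d) = f d) {d : ZMod p} (hd : d ≠ 0) :
    ∑ x, f x = f 0 + ((p : ℝ) - 1) * f d := by
  have hconst (x : ZMod p) (hx : x ∈ Finset.univ.erase 0) : f x = f d := by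
    have hx0 : x / d ≠ 0 := div_ne_zero (Finset.ne_of_mem_erase hx) hd
    have hxd : x / d * d = x := div_mul_cancel₀ x hd
    rcases isSquare_or_isSquare_neg hp (x / d) with h | h
    · rw [← hmul _ d hx0 h, hxd]
    · rw [← hmul _ d (neg_ne_zero.mpr hx0) h, neg_mul, hneg, hxd]
  rw [← Finset.add_sum_erase _ _ (Finset.mem_univ 0), Finset.sum_congr rfl hconst,
    Finset.sum_const, Finset.card_erase_of_mem (Finset.mem_univ _), Finset.card_univ, ZMod.card,
    nsmul_eq_mul, Nat.cast_pred (Fact.out : p.Prime).pos]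

lemma pairCount_sub (hp : p % 4 = 3) (hn : (p : ℝ) = 2 * n + 1) (hq : Function.Injective q)
    (hqr : Set.range q = {x : ZMod p | x ≠ 0 ∧ IsSquare x}) {α d : ZMod p} (hα : α ≠ 0)
    (hd : d ≠ 0) : 2 * pairCount q α (-α) d = n - 1 := by
  have h := sum_eq_of_invariant hp (f := pairCount q α (-α))
    (fun d => by rw [pairCount_neg, neg_neg])
    (fun u d hu hsq => pairCount_mul hq hqr hu hsq _ _ d) hd
  have h0 : pairCount q α (-α) 0 = n := by
    have (s s' : Fin n) : α * q s + -α * q s' = 0 ↔ s = s' := by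
      rw [neg_mul, ← sub_eq_add_neg, sub_eq_zero, mul_right_inj' hα, hq.eq_iff]
    simp only [pairCount, this]
    simp
  have hn0 : (n : ℝ) ≠ 0 := by
    rintro h
    have : (p : ℝ) = (1 : ℕ) := by rw [hn, h]; simp
    have := Nat.cast_injective this
    omega
  rw [sum_pairCount, h0, hn] at h
  exact mul_left_cancel₀ hn0 (by linarith)

lemma mul_ne_of_range_eq_squares
    (hqr : Set.range q = {x : ZMod p | x ≠ 0 ∧ IsSquare x}) {k : ZMod p} (hk : ¬ IsSquare k)
    (s s' : Fin n) : q s ≠ k * q s' := by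
  intro h
  have hs : q s ∈ {x : ZMod p | x ≠ 0 ∧ IsSquare x} := hqr ▸ Set.mem_range_self s
  have hs' : q s' ∈ {x : ZMod p | x ≠ 0 ∧ IsSquare x} := hqr ▸ Set.mem_range_self s'
  apply hk
  rw [eq_div_of_mul_eq hs'.1 h.symm]
  exact hs.2.div hs'.2

lemma pairCount_nonresidue (hp : p % 4 = 3) (hn : (p : ℝ) = 2 * n + 1)
    (hq : Function.Injective q) (hqr : Set.range q = {x : ZMod p | x ≠ 0 ∧ IsSquare x})
    {k d : ZMod p} (hk : ¬ IsSquare k) (hd : d ≠ 0) :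
    pairCount q 1 (-k) d + pairCount q k (-1) d = n := by
  have h := sum_eq_of_invariant hp (f := fun d => pairCount q 1 (-k) d + pairCount q k (-1) d)
    (fun d => by simp only [pairCount_neg, neg_neg]; ring)
    (fun u d hu hsq => by simp only [pairCount_mul hq hqr hu hsq]) hd
  have hne := mul_ne_of_range_eq_squares hqr hk
  have h0 : pairCount q 1 (-k) 0 = 0 := by
    simp [pairCount, ← sub_eq_add_neg, sub_eq_zero, hne]
  have h0' : pairCount q k (-1) 0 = 0 := by
    simp [pairCount, ← sub_eq_add_neg, sub_eq_zero, fun s s' => (hne s s').symm]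
  have hn0 : (n : ℝ) ≠ 0 := by
    rintro h
    have : (p : ℝ) = (1 : ℕ) := by rw [hn, h]; simp
    have := Nat.cast_injective this
    omega
  simp only [Finset.sum_add_distrib, sum_pairCount, h0, h0'] at h
  rw [hn] at h
  exact mul_left_cancel₀ hn0 (by linarith)

/-- The generators `e_{q s + c} + ε s • C • e_{k q s + c}` of a residue plane. -/
noncomputable def residueVec (q : Fin n → ZMod p) (k : ZMod p) (C : ℝ) (ε : Fin n → ℝ)
    (c : ZMod p) (s : Fin n) : ZMod p → ℝ :=
  Pi.single (q s + c) 1 + (ε s * C) • Pi.single (k * q s + c) 1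

lemma residueVec_dotProduct_same (hq : Function.Injective q)
    (hqr : Set.range q = {x : ZMod p | x ≠ 0 ∧ IsSquare x}) {k : ZMod p} (hk : ¬ IsSquare k)
    (C : ℝ) (ε ε' : Fin n → ℝ) (c : ZMod p) (s s' : Fin n) :
    residueVec q k C ε c s ⬝ᵥ residueVec q k C ε' c s' =
      if s = s' then 1 + ε s * ε' s * C ^ 2 else 0 := by
  have hk0 : k ≠ 0 := by rintro rfl; exact hk IsSquare.zero
  have hne := mul_ne_of_range_eq_squares hqr hk
  rw [residueVec, residueVec, dotProduct_single_add_smul_single]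
  simp only [add_left_inj, hne, (hne _ _).symm, mul_right_inj' hk0, hq.eq_iff, if_false]
  split_ifs with h
  · subst h; ring
  · ring

lemma sq_add_of_exclusive {A B D E : Prop} [Decidable A] [Decidable B] [Decidable D] [Decidable E]
    {C α β : ℝ} (hα : α ^ 2 = 1) (hβ : β ^ 2 = 1) (hAB : ¬ (A ∧ B)) (hAD : ¬ (A ∧ D))
    (hAE : ¬ (A ∧ E)) (hBD : ¬ (B ∧ D)) (hBE : ¬ (B ∧ E)) (hDE : ¬ (D ∧ E)) :
    ((if A then (1 : ℝ) else 0) + β * C * (if B then 1 else 0) + α * C * (if D then 1 else 0) +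
        α * C * (β * C) * (if E then 1 else 0)) ^ 2 =
      (if A then 1 else 0) + C ^ 2 * (if B then 1 else 0) + C ^ 2 * (if D then 1 else 0) +
        C ^ 4 * (if E then 1 else 0) := by
  by_cases hA : A
  · simp_all
  by_cases hB : B
  · have hD : ¬ D := fun h => hBD ⟨hB, h⟩
    have hE : ¬ E := fun h => hBE ⟨hB, h⟩
    simp [hA, hB, hD, hE, mul_pow, hβ]
  by_cases hD : D
  · have hE : ¬ E := fun h => hDE ⟨hD, h⟩
    simp [hA, hB, hD, hE, mul_pow, hα]
  by_cases hE : E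
  · simp only [hA, hB, hD, hE, if_true, if_false]
    linear_combination C ^ 4 * α ^ 2 * hβ + C ^ 4 * hα
  · simp [hA, hB, hD, hE]

lemma sum_residueVec_dotProduct_of_ne (hp : p % 4 = 3) (hn : (p : ℝ) = 2 * n + 1)
    (hq : Function.Injective q) (hqr : Set.range q = {x : ZMod p | x ≠ 0 ∧ IsSquare x})
    {k : ZMod p} (hk : ¬ IsSquare k) (C : ℝ) {ε ε' : Fin n → ℝ} (hε : ∀ s, ε s ^ 2 = 1)
    (hε' : ∀ s, ε' s ^ 2 = 1) {c c' : ZMod p} (hc : c ≠ c') :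
    ∑ s, ∑ s', (residueVec q k C ε c s ⬝ᵥ residueVec q k C ε' c' s') ^ 2 =
      (n - 1) / 2 * (1 + C ^ 4) + n * C ^ 2 := by
  have hk0 : k ≠ 0 := by rintro rfl; exact hk IsSquare.zero
  have hk1 : k - 1 ≠ 0 := by
    rw [sub_ne_zero]; rintro rfl; exact hk IsSquare.one
  have hd : c' - c ≠ 0 := sub_ne_zero.mpr hc.symm
  have hne := mul_ne_of_range_eq_squares hqr hk
  have hneg (s s' : Fin n) : q s ≠ -1 * q s' :=
    mul_ne_of_range_eq_squares hqr (by rw [ZMod.exists_sq_eq_neg_one_iff]; omega) s s'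
  have expand (s s' : Fin n) :
      (residueVec q k C ε c s ⬝ᵥ residueVec q k C ε' c' s') ^ 2 =
        (if 1 * q s + -1 * q s' = c' - c then 1 else 0) +
        C ^ 2 * (if 1 * q s + -k * q s' = c' - c then 1 else 0) +
        C ^ 2 * (if k * q s + -1 * q s' = c' - c then 1 else 0) +
        C ^ 4 * (if k * q s + -k * q s' = c' - c then 1 else 0) := by
    have eqv (x y x' y' : ZMod p) : x * y + -x' * y' = c' - c ↔ x * y + c = x' * y' + c' := by
      constructor <;> intro h <;> linear_combination h
    have e11 := eqv 1 (q s) 1 (q s')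
    have e1k := eqv 1 (q s) k (q s')
    have ek1 := eqv k (q s) 1 (q s')
    have ekk := eqv k (q s) k (q s')
    simp only [one_mul] at e11 e1k ek1
    simp only [one_mul, e11, e1k, ek1, ekk]
    rw [residueVec, residueVec, dotProduct_single_add_smul_single]
    have h12 : ¬ (q s + c = q s' + c' ∧ q s + c = k * q s' + c') := fun h =>
      hne s' s' (by linear_combination h.2 - h.1)
    have h13 : ¬ (q s + c = q s' + c' ∧ k * q s + c = q s' + c') := fun h =>
      hne s s (by linear_combination h.1 - h.2)
    have h14 : ¬ (q s + c = q s' + c' ∧ k * q s + c = k * q s' + c') := fun h => by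
      have : q s = q s' := mul_left_cancel₀ hk1 (by linear_combination h.2 - h.1)
      exact hc (by linear_combination h.1 - this)
    have h23 : ¬ (q s + c = k * q s' + c' ∧ k * q s + c = q s' + c') := fun h =>
      hneg s s' (mul_left_cancel₀ hk1 (by linear_combination h.2 - h.1))
    have h24 : ¬ (q s + c = k * q s' + c' ∧ k * q s + c = k * q s' + c') := fun h =>
      hne s s (by linear_combination h.1 - h.2)
    have h34 : ¬ (k * q s + c = q s' + c' ∧ k * q s + c = k * q s' + c') := fun h =>
      hne s' s' (by linear_combination h.2 - h.1)
    exact sq_add_of_exclusive (hε s) (hε' s') h12 h13 h14 h23 h24 h34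
  have hcount : ∑ s, ∑ s', (residueVec q k C ε c s ⬝ᵥ residueVec q k C ε' c' s') ^ 2 =
      pairCount q 1 (-1) (c' - c) + C ^ 2 * pairCount q 1 (-k) (c' - c) +
        C ^ 2 * pairCount q k (-1) (c' - c) + C ^ 4 * pairCount q k (-k) (c' - c) := by
    simp only [expand, pairCount, Finset.mul_sum, Finset.sum_add_distrib]
  rw [hcount]
  linear_combination (1 / 2) * pairCount_sub hp hn hq hqr one_ne_zero hd +
    (C ^ 4 / 2) * pairCount_sub hp hn hq hqr hk0 hd +
    C ^ 2 * pairCount_nonresidue hp hn hq hqr hk hd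

lemma sum_residueVec_dotProduct_same (hq : Function.Injective q)
    (hqr : Set.range q = {x : ZMod p | x ≠ 0 ∧ IsSquare x}) {k : ZMod p} (hk : ¬ IsSquare k)
    (C : ℝ) {ε ε' : Fin n → ℝ} (hε : ∀ s, ε s ^ 2 = 1) (hε' : ∀ s, ε' s ^ 2 = 1)
    (c : ZMod p) :
    ∑ s, ∑ s', (residueVec q k C ε c s ⬝ᵥ residueVec q k C ε' c s') ^ 2 =
      n * (1 + C ^ 4) + 2 * C ^ 2 * ∑ s, ε s * ε' s := by
  have expand (s : Fin n) : (1 + ε s * ε' s * C ^ 2) ^ 2 =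
      (1 + C ^ 4) + 2 * C ^ 2 * (ε s * ε' s) := by
    linear_combination C ^ 4 * ε s ^ 2 * hε' s + C ^ 4 * hε s
  simp only [residueVec_dotProduct_same hq hqr hk, ite_pow, ne_eq, OfNat.ofNat_ne_zero,
    not_false_eq_true, zero_pow, Finset.sum_ite_eq, Finset.mem_univ, if_true, expand,
    Finset.sum_add_distrib, Finset.sum_const, Finset.card_univ, Fintype.card_fin, nsmul_eq_mul,
    ← Finset.mul_sum]
  ring

end Residues

/-- for a prime `p` with `p = 3` or `p ≡ 7 (mod 8)`, a normalized
    Hadamard matrix `H` of order `(p+1)/2`, an enumeration `q` of the nonzero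
    quadratic residues mod `p`, a fixed nonresidue `k`, and
    `C = (1 + √(p+2))/√(p+1)`, the planes
    `P_{t,c} = span{e_{q_s + c} + H_{s,t}·C·e_{k·q_s + c} : 1 ≤ s ≤ (p−1)/2}`
    form `p(p+1)/2` pairwise distinct `(p−1)/2`-dimensional subspaces of `ℝ^p`, any
    two of which are at squared chordal distance exactly `(p+1)²/(4(p+2))`, which
    equals the simplex bound for `m = p`, `n = (p−1)/2`, `N = p(p+1)/2`. -/
theorem stmt19 (p : ℕ) [Fact p.Prime] (hp : p = 3 ∨ p % 8 = 7)
    (H : Matrix (Fin ((p - 1) / 2 + 1)) (Fin ((p - 1) / 2 + 1)) ℝ)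
    (hHpm : ∀ s t, H s t = 1 ∨ H s t = -1)
    (hHorth : H * Hᵀ = (((p : ℝ) + 1) / 2) • (1 : Matrix _ _ ℝ))
    (hHrow : ∀ t, H 0 t = 1) (hHcol : ∀ s, H s 0 = 1)
    (q : Fin ((p - 1) / 2) → ZMod p) (hq : Function.Injective q)
    (hqr : Set.range q = {x : ZMod p | x ≠ 0 ∧ IsSquare x})
    (k : ZMod p) (hk : ¬ IsSquare k) :
    let C : ℝ := (1 + Real.sqrt ((p : ℝ) + 2)) / Real.sqrt ((p : ℝ) + 1)
    let P : Fin ((p - 1) / 2 + 1) → ZMod p → Submodule ℝ (ZMod p → ℝ) :=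
      fun t c => Submodule.span ℝ
        (Set.range fun s : Fin ((p - 1) / 2) =>
          (Pi.single (q s + c) (1 : ℝ) : ZMod p → ℝ) +
            (H s.succ t * C) • (Pi.single (k * q s + c) (1 : ℝ) : ZMod p → ℝ))
    Function.Injective (fun tc : Fin ((p - 1) / 2 + 1) × ZMod p => P tc.1 tc.2) ∧
    Nat.card ↥(Set.range fun tc : Fin ((p - 1) / 2 + 1) × ZMod p => P tc.1 tc.2) * 2 =
      p * (p + 1) ∧
    (∀ t c, Module.finrank ℝ (P t c) = (p - 1) / 2) ∧
    (∀ t c t' c', P t c ≠ P t' c' →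
      ∀ M M' : Matrix (ZMod p) (ZMod p) ℝ,
        IsProjOnto M (P t c) → IsProjOnto M' (P t' c') →
        (1 / 2 : ℝ) * frobSq (M - M') = ((p : ℝ) + 1) ^ 2 / (4 * ((p : ℝ) + 2))) ∧
    ((p : ℝ) + 1) ^ 2 / (4 * ((p : ℝ) + 2)) =
      (((p : ℝ) - 1) / 2) * ((p : ℝ) - ((p : ℝ) - 1) / 2) / (p : ℝ) *
        (((p : ℝ) * ((p : ℝ) + 1) / 2) / ((p : ℝ) * ((p : ℝ) + 1) / 2 - 1)) := by
  have hp4 : p % 4 = 3 := by omega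
  have hn : (p : ℝ) = 2 * ((p - 1) / 2 : ℕ) + 1 := by
    have : p = 2 * ((p - 1) / 2) + 1 := by omega
    exact_mod_cast this
  have hcard : ((p - 1) / 2 + 1) * 2 = p + 1 := by omega
  have hp3' : (3 : ℝ) ≤ p := by
    have : 3 ≤ p := by omega
    exact_mod_cast this
  generalize (p - 1) / 2 = n at *
  intro C P
  set r : ℝ := Real.sqrt ((p : ℝ) + 2) with hr
  have hr2 : r ^ 2 = p + 2 := Real.sq_sqrt (by linarith)
  have hr1 : 1 < r := by
    rw [hr]; exact Real.lt_sqrt_of_sq_lt (by linarith)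
  have hr1' : r - 1 ≠ 0 := by linarith
  have hr0 : r ≠ 0 := by linarith
  have hC : C ^ 2 = (r + 1) / (r - 1) := by
    have hs2 : Real.sqrt ((p : ℝ) + 1) ^ 2 = (r - 1) * (r + 1) := by
      rw [Real.sq_sqrt (by linarith)]; linear_combination -hr2
    have hr1p : r + 1 ≠ 0 := by linarith
    simp only [C, div_pow, hs2]
    field_simp
    ring
  set a : ℝ := 1 + C ^ 2 with ha
  have ha0 : a ≠ 0 := by positivity
  have hsq (s t) : H s t ^ 2 = 1 := by
    rcases hHpm s t with h | h <;> rw [h] <;> norm_num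
  let w (t : Fin (n + 1)) (c : ZMod p) : Fin n → ZMod p → ℝ :=
    residueVec q k C (fun s => H s.succ t) c
  have hw (t c) (s s' : Fin n) : w t c s ⬝ᵥ w t c s' = if s = s' then a else 0 := by
    simp only [w]
    rw [residueVec_dotProduct_same hq hqr hk, ← pow_two, hsq, one_mul]
  have hP (t c) : P t c = Submodule.span ℝ (Set.range (w t c)) := rfl
  have hproj (t c) : IsProjOnto (orthoProj a (w t c)) (P t c) := orthoProj_isProjOnto ha0 (hw t c)
  have htr (t c) : (orthoProj a (w t c) * orthoProj a (w t c)).trace = n := by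
    simp [trace_orthoProj_mul, hw, ite_pow]
    field_simp
  have hdist (t c t' c') (h : (t, c) ≠ (t', c')) :
      (1 / 2 : ℝ) * frobSq (orthoProj a (w t c) - orthoProj a (w t' c')) =
        ((p : ℝ) + 1) ^ 2 / (4 * ((p : ℝ) + 2)) := by
    have hpr : (p : ℝ) = r ^ 2 - 2 := by linarith
    have hnr : (n : ℝ) = (r ^ 2 - 3) / 2 := by linarith
    have har : a = 2 * r / (r - 1) := by rw [ha, hC]; field_simp; ring
    have hC4 : C ^ 4 = ((r + 1) / (r - 1)) ^ 2 := by rw [← hC]; ring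
    rw [frobSq_sub (hproj t c).1 (hproj t' c').1, htr, htr, trace_orthoProj_mul]
    by_cases hc : c = c'
    · subst hc
      have ht : t ≠ t' := fun ht => h (by rw [ht])
      rw [sum_residueVec_dotProduct_same hq hqr hk C (fun s => hsq s.succ t)
        (fun s => hsq s.succ t') c,
        sum_mul_column_of_hadamard (by positivity) hHorth hHrow ht, har, hC, hC4, hnr, hpr]
      field_simp
      ring
    · rw [sum_residueVec_dotProduct_of_ne hp4 hn hq hqr hk C (fun s => hsq s.succ t)
        (fun s => hsq s.succ t') hc, har, hC, hC4, hnr, hpr]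
      field_simp
      ring
  have hinj : Function.Injective (fun tc : Fin (n + 1) × ZMod p => P tc.1 tc.2) := by
    rintro ⟨t, c⟩ ⟨t', c'⟩ h
    by_contra hne
    have hd := hdist t c t' c' hne
    have heq : P t c = P t' c' := h
    rw [(hproj t c).unique_s19 (heq ▸ hproj t' c'), sub_self] at hd
    have hpos : 0 < ((p : ℝ) + 1) ^ 2 / (4 * ((p : ℝ) + 2)) := by positivity
    rw [← hd] at hpos
    simp [frobSq] at hpos
  refine ⟨hinj, ?_, fun t c => ?_, fun t c t' c' hne M M' hM hM' => ?_, ?_⟩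
  · rw [Nat.card_range_of_injective hinj, Nat.card_prod, Nat.card_fin, Nat.card_zmod]
    rw [mul_right_comm, hcard, mul_comm]
  · rw [hP, finrank_span_eq_card (linearIndependent_of_dotProduct ha0 (hw t c)), Fintype.card_fin]
  · rw [hM.unique_s19 (hproj t c), hM'.unique_s19 (hproj t' c')]
    refine hdist t c t' c' fun h => ?_
    obtain ⟨rfl, rfl⟩ := Prod.mk.inj h
    exact hne rfl
  · have h1 : (p : ℝ) * (p + 1) / 2 - 1 ≠ 0 := by nlinarith
    have h2 : (p : ℝ) * (p + 1) - 2 ≠ 0 := fun h => h1 (by linarith)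
    field_simp
    ring
end
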